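/- Translated barbed bisimilarity includes structural congruence: for all asynchronous π-calculus terms T₁ and T₂, if T₁ ≡ T₂ then T₁ ≐ˢₐ T₂ and T₁ ≐ᵐₐ T₂. -/

import Mathlib

set_option autoImplicit true
set_option relaxedAutoImplicit true
set_option maxHeartbeats 1000000

namespace PiCalc

/-! # The π-calculi πₘ (mixed choice), πₛ (separate choice) and πₐ (asynchronous)

Formalization of the setting of Peters/Nestmann, "On the Expressiveness of Mixed Choice"
(technical report).  Names are natural numbers; a single syntax covers all three calculi,
with subcalculi carved out by predicates.  Sums are built from the empty sum `nil`,
guarded terms and binary `choice`. -/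

abbrev Name : Type := ℕ

inductive Proc : Type
  | nil : Proc                               -- empty sum 0
  | succ : Proc                              -- success ✓
  | res : Name → Proc → Proc                 -- (νx)P
  | par : Proc → Proc → Proc                 -- P | Q
  | mat : Name → Name → Proc → Proc          -- [a = b]P
  | inp : Name → List Name → Proc → Proc     -- y(x̃).P
  | out : Name → List Name → Proc → Proc     -- ȳ⟨z̃⟩.P  (asynchronous output: continuation nil)
  | rep : Name → List Name → Proc → Proc     -- y*(x̃).P (replicated input)
  | tau : Proc → Proc                        -- τ.P
  | choice : Proc → Proc → Proc              -- P + Q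
  deriving DecidableEq

/-- Free names of a process. -/
def freeNames : Proc → Finset Name
  | .nil => ∅
  | .succ => ∅
  | .res x P => freeNames P \ {x}
  | .par P Q => freeNames P ∪ freeNames Q
  | .mat a b P => insert a (insert b (freeNames P))
  | .inp y xs P => insert y (freeNames P \ xs.toFinset)
  | .out y zs P => insert y (zs.toFinset ∪ freeNames P)
  | .rep y xs P => insert y (freeNames P \ xs.toFinset)
  | .tau P => freeNames P
  | .choice P Q => freeNames P ∪ freeNames Q

/-- All names (free or bound) occurring in a process. -/
def allNames : Proc → Finset Name
  | .nil => ∅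
  | .succ => ∅
  | .res x P => insert x (allNames P)
  | .par P Q => allNames P ∪ allNames Q
  | .mat a b P => insert a (insert b (allNames P))
  | .inp y xs P => insert y (xs.toFinset ∪ allNames P)
  | .out y zs P => insert y (zs.toFinset ∪ allNames P)
  | .rep y xs P => insert y (xs.toFinset ∪ allNames P)
  | .tau P => allNames P
  | .choice P Q => allNames P ∪ allNames Q

/-! ## Alpha-equivalence, via a de Bruijn normal form -/

inductive DBName : Type
  | free : Name → DBName
  | bound : ℕ → DBName
  deriving DecidableEq

inductive DB : Type
  | nil : DB
  | succ : DB
  | res : DB → DB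
  | par : DB → DB → DB
  | mat : DBName → DBName → DB → DB
  | inp : DBName → ℕ → DB → DB
  | out : DBName → List DBName → DB → DB
  | rep : DBName → ℕ → DB → DB
  | tau : DB → DB
  | choice : DB → DB → DB
  deriving DecidableEq

def dbVar (env : List Name) (x : Name) : DBName :=
  match env.findIdx? (· == x) with
  | some i => .bound i
  | none => .free x

def toDB : List Name → Proc → DB
  | _, .nil => .nil
  | _, .succ => .succ
  | env, .res x P => .res (toDB (x :: env) P)
  | env, .par P Q => .par (toDB env P) (toDB env Q)
  | env, .mat a b P => .mat (dbVar env a) (dbVar env b) (toDB env P)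
  | env, .inp y xs P => .inp (dbVar env y) xs.length (toDB (xs.reverse ++ env) P)
  | env, .out y zs P => .out (dbVar env y) (zs.map (dbVar env)) (toDB env P)
  | env, .rep y xs P => .rep (dbVar env y) xs.length (toDB (xs.reverse ++ env) P)
  | env, .tau P => .tau (toDB env P)
  | env, .choice P Q => .choice (toDB env P) (toDB env Q)

/-- `P` and `Q` are alpha-equivalent (differ only in the choice of bound names). -/
def AlphaEq (P Q : Proc) : Prop := toDB [] P = toDB [] Q

/-! ## Capture-avoiding substitution -/

def freshName (avoid : Finset Name) : Name := avoid.sup id + 1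

def freshNames : Finset Name → ℕ → List Name
  | _, 0 => []
  | avoid, n + 1 => freshName avoid :: freshNames (insert (freshName avoid) avoid) n

/-- Simultaneous update of a substitution on lists of names. -/
def updates (σ : Name → Name) : List Name → List Name → Name → Name
  | x :: xs, z :: zs => Function.update (updates σ xs zs) x z
  | _, _ => σ

def applySubstAux : (Name → Name) → Finset Name → Proc → Proc
  | _, _, .nil => .nil
  | _, _, .succ => .succ
  | σ, avoid, .res x P =>
      let x' := freshName avoid
      .res x' (applySubstAux (Function.update σ x x') (insert x' avoid) P)
  | σ, avoid, .par P Q => .par (applySubstAux σ avoid P) (applySubstAux σ avoid Q)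
  | σ, avoid, .mat a b P => .mat (σ a) (σ b) (applySubstAux σ avoid P)
  | σ, avoid, .inp y xs P =>
      let xs' := freshNames avoid xs.length
      .inp (σ y) xs' (applySubstAux (updates σ xs xs') (avoid ∪ xs'.toFinset) P)
  | σ, avoid, .out y zs P => .out (σ y) (zs.map σ) (applySubstAux σ avoid P)
  | σ, avoid, .rep y xs P =>
      let xs' := freshNames avoid xs.length
      .rep (σ y) xs' (applySubstAux (updates σ xs xs') (avoid ∪ xs'.toFinset) P)
  | σ, avoid, .tau P => .tau (applySubstAux σ avoid P)
  | σ, avoid, .choice P Q => .choice (applySubstAux σ avoid P) (applySubstAux σ avoid Q)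

/-- Application `σ(P)` of a substitution to a process, silently alpha-converting
all binders to avoid capture and name clashes. -/
def applySubst (σ : Name → Name) (P : Proc) : Proc :=
  applySubstAux σ (allNames P ∪ (allNames P).image σ) P

/-- For an injective renaming policy `φ`, the substitution
`φ(σ) = {φ(y₁)/φ(x₁), …, φ(yₙ)/φ(xₙ)}` induced by `σ = {y₁/x₁, …, yₙ/xₙ}`. -/
noncomputable def mapSubst (φ σ : Name → Name) : Name → Name :=
  fun m =>
    letI := Classical.propDecidable (∃ n, φ n = m)
    if h : ∃ n, φ n = m then φ (σ (Classical.choose h)) else m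

def resList : List Name → Proc → Proc
  | [], P => P
  | x :: xs, P => .res x (resList xs P)

def parList : List Proc → Proc
  | [] => .nil
  | [P] => P
  | P :: Ps => .par P (parList Ps)

/-! ## Structural congruence (Figure 1); the flag `true` additionally allows
splitting of replicated inputs (`≡ᵣₑₚ`). -/

inductive StructCongX : Bool → Proc → Proc → Prop
  | alpha {b : Bool} {P Q : Proc} : AlphaEq P Q → StructCongX b P Q
  | parNil {b : Bool} {P : Proc} : StructCongX b (.par P .nil) P
  | parComm {b : Bool} {P Q : Proc} : StructCongX b (.par P Q) (.par Q P)
  | parAssoc {b : Bool} {P Q R : Proc} :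
      StructCongX b (.par P (.par Q R)) (.par (.par P Q) R)
  | matElim {b : Bool} {a : Name} {P : Proc} : StructCongX b (.mat a a P) P
  | resNil {b : Bool} {n : Name} : StructCongX b (.res n .nil) .nil
  | resSwap {b : Bool} {n m : Name} {P : Proc} :
      StructCongX b (.res n (.res m P)) (.res m (.res n P))
  | resPar {b : Bool} {n : Name} {P Q : Proc} :
      n ∉ freeNames P → StructCongX b (.par P (.res n Q)) (.res n (.par P Q))
  | repSplit {y : Name} {xs : List Name} {P : Proc} :
      StructCongX true (.rep y xs P) (.par (.rep y xs P) (.rep y xs P))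
  | refl {b : Bool} {P : Proc} : StructCongX b P P
  | symm {b : Bool} {P Q : Proc} : StructCongX b P Q → StructCongX b Q P
  | trans {b : Bool} {P Q R : Proc} :
      StructCongX b P Q → StructCongX b Q R → StructCongX b P R
  | resCong {b : Bool} {x : Name} {P Q : Proc} :
      StructCongX b P Q → StructCongX b (.res x P) (.res x Q)
  | parCong {b : Bool} {P P' Q Q' : Proc} :
      StructCongX b P P' → StructCongX b Q Q' → StructCongX b (.par P Q) (.par P' Q')

/-- Structural congruence `≡`. -/
abbrev StructCong : Proc → Proc → Prop := StructCongX false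
/-- Structural congruence `≡ᵣₑₚ` extended by `y*(x̃).P ≡ y*(x̃).P | y*(x̃).P`. -/
abbrev StructCongRep : Proc → Proc → Prop := StructCongX true

/-! ## Reduction semantics (Figure 2 of the preliminaries) -/

/-- `IsSummand G S`: the (guarded) term `G` occurs as a summand of the sum `S`. -/
inductive IsSummand : Proc → Proc → Prop
  | refl (P : Proc) : IsSummand P P
  | left {P Q R : Proc} : IsSummand P Q → IsSummand P (.choice Q R)
  | right {P Q R : Proc} : IsSummand P R → IsSummand P (.choice Q R)

/-- Labelled reduction: the label records the channel of the interaction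
(`none` for a step of a τ-guarded summand). -/
inductive LabStep : Proc → Option Name → Proc → Prop
  | tauStep {P S : Proc} : IsSummand (.tau P) S → LabStep S none P
  | com {y : Name} {xs zs : List Name} {P Q S₁ S₂ : Proc} :
      xs.length = zs.length →
      IsSummand (.inp y xs P) S₁ → IsSummand (.out y zs Q) S₂ →
      LabStep (.par S₁ S₂) (some y) (.par (applySubst (updates id xs zs) P) Q)
  | repStep {y : Name} {xs zs : List Name} {P Q S : Proc} :
      xs.length = zs.length →
      IsSummand (.out y zs Q) S →
      LabStep (.par (.rep y xs P) S) (some y)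
        (.par (applySubst (updates id xs zs) P) (.par Q (.rep y xs P)))
  | parStep {P P' Q : Proc} {a : Option Name} :
      LabStep P a P' → LabStep (.par P Q) a (.par P' Q)
  | resStep {P P' : Proc} {x : Name} {a : Option Name} :
      LabStep P a P' → LabStep (.res x P) a (.res x P')
  | congr {P P' Q Q' : Proc} {a : Option Name} :
      StructCong P P' → LabStep P' a Q' → StructCong Q' Q → LabStep P a Q

/-- One reduction step `P ⟶ Q`. -/
def Reduces (P Q : Proc) : Prop := ∃ a, LabStep P a Q

/-- `P ⟹ Q`: reflexive-transitive closure of reduction. -/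
def Steps : Proc → Proc → Prop := Relation.ReflTransGen Reduces

/-- `P ⟶^ω`: `P` has an infinite sequence of reduction steps. -/
def Divergent (P : Proc) : Prop := ∃ f : ℕ → Proc, f 0 = P ∧ ∀ n, Reduces (f n) (f (n + 1))

/-- `P ⇓✓`: `P` may lead to success. -/
def reachSuccess (P : Proc) : Prop :=
  ∃ P' P'' : Proc, Steps P P' ∧ StructCong P' (.par P'' .succ)

/-! ## The subcalculi -/

mutual
  /-- `P` is a term of the π-calculus with mixed choice πₘ. -/
  inductive IsMix : Proc → Prop
    | succ : IsMix .succ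
    | res {x : Name} {P : Proc} : IsMix P → IsMix (.res x P)
    | par {P Q : Proc} : IsMix P → IsMix Q → IsMix (.par P Q)
    | mat {a c : Name} {P : Proc} : IsMix P → IsMix (.mat a c P)
    | rep {y x : Name} {P : Proc} : IsMix P → IsMix (.rep y [x] P)
    | sum {P : Proc} : IsMixSum P → IsMix P
  /-- `P` is a (possibly empty) mixed-choice sum of guarded πₘ terms. -/
  inductive IsMixSum : Proc → Prop
    | nil : IsMixSum .nil
    | inp {y x : Name} {P : Proc} : IsMix P → IsMixSum (.inp y [x] P)
    | out {y z : Name} {P : Proc} : IsMix P → IsMixSum (.out y [z] P)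
    | tau {P : Proc} : IsMix P → IsMixSum (.tau P)
    | choice {P Q : Proc} : IsMixSum P → IsMixSum Q → IsMixSum (.choice P Q)
end

mutual
  /-- `P` is a term of the π-calculus with separate choice πₛ. -/
  inductive IsSep : Proc → Prop
    | succ : IsSep .succ
    | res {x : Name} {P : Proc} : IsSep P → IsSep (.res x P)
    | par {P Q : Proc} : IsSep P → IsSep Q → IsSep (.par P Q)
    | mat {a c : Name} {P : Proc} : IsSep P → IsSep (.mat a c P)
    | rep {y x : Name} {P : Proc} : IsSep P → IsSep (.rep y [x] P)
    | sumIn {P : Proc} : IsSepIn P → IsSep P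
    | sumOut {P : Proc} : IsSepOut P → IsSep P
  /-- a sum all of whose guards are inputs or τ -/
  inductive IsSepIn : Proc → Prop
    | nil : IsSepIn .nil
    | inp {y x : Name} {P : Proc} : IsSep P → IsSepIn (.inp y [x] P)
    | tau {P : Proc} : IsSep P → IsSepIn (.tau P)
    | choice {P Q : Proc} : IsSepIn P → IsSepIn Q → IsSepIn (.choice P Q)
  /-- a sum all of whose guards are outputs or τ -/
  inductive IsSepOut : Proc → Prop
    | nil : IsSepOut .nil
    | out {y z : Name} {P : Proc} : IsSep P → IsSepOut (.out y [z] P)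
    | tau {P : Proc} : IsSep P → IsSepOut (.tau P)
    | choice {P Q : Proc} : IsSepOut P → IsSepOut Q → IsSepOut (.choice P Q)
end

/-- `P` is a term of the (polyadic) asynchronous π-calculus πₐ. -/
inductive IsAsync : Proc → Prop
  | nil : IsAsync .nil
  | succ : IsAsync .succ
  | res {x : Name} {P : Proc} : IsAsync P → IsAsync (.res x P)
  | par {P Q : Proc} : IsAsync P → IsAsync Q → IsAsync (.par P Q)
  | mat {a c : Name} {P : Proc} : IsAsync P → IsAsync (.mat a c P)
  | out {y : Name} {zs : List Name} : IsAsync (.out y zs .nil)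
  | inp {y : Name} {xs : List Name} {P : Proc} : IsAsync P → IsAsync (.inp y xs P)
  | tau {P : Proc} : IsAsync P → IsAsync (.tau P)
  | rep {y : Name} {xs : List Name} {P : Proc} : IsAsync P → IsAsync (.rep y xs P)

/-- A guarded πₘ term `π.P` (a potential summand). -/
def IsGuardedMix (g : Proc) : Prop :=
  match g with
  | .inp _ [_] P => IsMix P
  | .out _ [_] P => IsMix P
  | .tau P => IsMix P
  | _ => False

/-- A guarded πₛ term `π.P` (a potential summand). -/
def IsGuardedSep (g : Proc) : Prop :=
  match g with
  | .inp _ [_] P => IsSep P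
  | .out _ [_] P => IsSep P
  | .tau P => IsSep P
  | _ => False

/-! ## Reserved names, booleans and test-statements -/

def nT : Name := 0      -- t
def nF : Name := 1      -- f
def nL : Name := 2      -- sum lock l
def nL' : Name := 3     -- sum lock l'
def nS : Name := 4      -- sender lock s
def nR : Name := 5      -- receiver lock r
def nPo : Name := 6     -- request channel p_o
def nPi : Name := 7     -- request channel p_i
def nMo : Name := 8     -- m_o
def nMi : Name := 9     -- m_i
def nCo : Name := 10    -- c_o
def nCi : Name := 11    -- c_i
def nCmo : Name := 12   -- c_{m,o}
def nCmi : Name := 13   -- c_{m,i}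
def nMuo : Name := 14   -- m_{up,o}
def nMui : Name := 15   -- m_{up,i}
def nLs : Name := 16    -- l_s
def nLr : Name := 17    -- l_r
def nL1 : Name := 18    -- l₁
def nL2 : Name := 19    -- l₂
def nCr1 : Name := 20   -- c_{r,1}
def nCr2 : Name := 21   -- c_{r,2}
def nMri : Name := 22   -- m_{r,i}
def nMro : Name := 23   -- m_{r,o}
def nMrui : Name := 24  -- m_{r,up,i}
def nMruo : Name := 25  -- m_{r,up,o}
def nY : Name := 26     -- y
def nY' : Name := 27    -- y'
def nZ : Name := 28     -- z
def nDash : Name := 29  -- the wildcard "−"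
def argBase : Name := 30

/-- The renaming policy φˢₐ: an injective substitution translating every source term
name into a single name different from all reserved names. -/
def phiSA : Name → Name := fun n => n + 50

/-- The renaming policy φᵐₐ. -/
def phiMA : Name → Name := fun n => n + 50

/-- Boolean instantiation `l⟨⊤⟩ ≜ l(t,f).t̄`. -/
def lockTrue (l : Name) : Proc := .inp l [nT, nF] (.out nT [] .nil)

/-- Boolean instantiation `l⟨⊥⟩ ≜ l(t,f).f̄`. -/
def lockFalse (l : Name) : Proc := .inp l [nT, nF] (.out nF [] .nil)

/-- `l⟨b⟩` for a boolean value `b`. -/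
def lockOut (l : Name) (b : Bool) : Proc := if b then lockTrue l else lockFalse l

/-- `test l then P else Q ≜ (νt,f)(l⟨t,f⟩ | t.P | f.Q)`. -/
def test (l : Name) (P Q : Proc) : Proc :=
  .res nT (.res nF (.par (.out l [nT, nF] .nil) (.par (.inp nT [] P) (.inp nF [] Q))))

/-- reserved argument names for forwarders -/
def fwArgs (n : ℕ) : List Name := (List.range n).map (fun i => argBase + i)

/-- Forwarder `y ↠ {y₁, …, yₖ}` for channels of multiplicity `n`. -/
def forward (y : Name) (ys : List Name) (n : ℕ) : Proc :=
  .rep y (fwArgs n) (parList (ys.map fun yi => .out yi (fwArgs n) .nil))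

/-! ## The encoding ⟦·⟧ˢₐ of πₛ into πₐ (Figure 2 / Nestmann) -/

/-- Computes simultaneously the translation of a term and (for potential summands)
the translation of the summand as a function of the surrounding sum lock. -/
def encSAcore : Proc → Proc × (Name → Proc)
  | .nil => (.res nL (.par (lockTrue nL) .nil), fun _ => .nil)
  | .succ => (.succ, fun _ => .nil)
  | .res x P => (.res (phiSA x) (encSAcore P).1, fun _ => .nil)
  | .par P Q => (.par (encSAcore P).1 (encSAcore Q).1, fun _ => .nil)
  | .mat a b P => (.mat (phiSA a) (phiSA b) (encSAcore P).1, fun _ => .nil)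
  | .rep y xs P =>
      (.rep (phiSA y) ([nL, nS] ++ xs.map phiSA)
          (test nL (.par (lockFalse nL) (.par (.out nS [] .nil) (encSAcore P).1))
            (lockFalse nL)),
       fun _ => .nil)
  | .tau P =>
      let e := (encSAcore P).1
      let s := fun l => test l (.par (lockFalse l) e) (lockFalse l)
      (.res nL (.par (lockTrue nL) (s nL)), s)
  | .out y zs P =>
      let e := (encSAcore P).1
      let s := fun l =>
        .res nS (.par (.out (phiSA y) ([l, nS] ++ zs.map phiSA) .nil) (.inp nS [] e))
      (.res nL (.par (lockTrue nL) (s nL)), s)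
  | .inp y xs P =>
      let e := (encSAcore P).1
      let s := fun l =>
        .res nR (.par (.out nR [] .nil)
          (.rep nR []
            (.inp (phiSA y) ([nL', nS] ++ xs.map phiSA)
              (test l
                (test nL'
                  (.par (lockFalse l)
                    (.par (lockFalse nL') (.par (.out nS [] .nil) e)))
                  (.par (lockTrue l) (.par (lockFalse nL') (.out nR [] .nil))))
                (.par (lockFalse l)
                  (.out (phiSA y) ([nL', nS] ++ xs.map phiSA) .nil))))))
      (.res nL (.par (lockTrue nL) (s nL)), s)
  | .choice P Q =>
      let a := (encSAcore P).2
      let b := (encSAcore Q).2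
      (.res nL (.par (lockTrue nL) (.par (a nL) (b nL))), fun l => .par (a l) (b l))

/-- The encoding `⟦·⟧ˢₐ` from πₛ into πₐ. -/
def encSA (P : Proc) : Proc := (encSAcore P).1

/-- `⟦π.P⟧ˢₐ` of a summand, with `l` as the sum lock of the surrounding sum. -/
def encSASummand (l : Name) (g : Proc) : Proc := (encSAcore g).2 l

/-! ## The encoding ⟦·⟧ᵐₐ of πₘ into πₐ (Figure 3) -/

/-- processing of right output requests in the parallel-operator encoding -/
def procRightOut : Proc :=
  .par (.out nCmo [nMi] .nil)
    (.rep nCmo [nMi]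
      (.inp nPo [nY, nLs, nS, nZ]
        (.par
          (.res nMui
            (.par
              (.rep nMi [nY', nLr, nR]
                (.par (.mat nY' nY (.out nR [nLr, nLs, nLs, nS, nZ] .nil))
                      (.out nMui [nY', nLr, nR] .nil)))
              (.res nMi (.par (forward nMui [nMi] 3) (.out nCmo [nMi] .nil)))))
          (.out nCo [nY, nLs, nS, nZ] .nil))))

/-- processing of right input requests in the parallel-operator encoding -/
def procRightIn : Proc :=
  .par (.out nCmi [nMo] .nil)
    (.rep nCmi [nMo]
      (.inp nPi [nY, nLr, nR]
        (.par
          (.res nMuo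
            (.par
              (.rep nMo [nY', nLs, nS, nZ]
                (.par (.mat nY' nY (.out nR [nLs, nLr, nLs, nS, nZ] .nil))
                      (.out nMuo [nY', nLs, nS, nZ] .nil)))
              (.res nMo (.par (forward nMuo [nMo] 4) (.out nCmi [nMo] .nil)))))
          (.out nCi [nY, nLr, nR] .nil))))

def procLeftOut : Proc := forward nPo [nMo, nCo] 4
def procLeftIn : Proc := forward nPi [nMi, nCi] 3
def pushReqs : Proc := .par (forward nCo [nPo] 4) (forward nCi [nPi] 3)

/-- The context introduced by `⟦P | Q⟧ᵐₐ` around `⟦P⟧ᵐₐ` and `⟦Q⟧ᵐₐ`. -/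
def encMApar (EP EQ : Proc) : Proc :=
  resList [nMo, nMi, nCo, nCi, nCmo, nCmi]
    (parList
      [ .res nPo (.res nPi (parList [EP, procLeftOut, procLeftIn]))
      , .res nPo (.res nPi (parList [EQ, procRightOut, procRightIn]))
      , pushReqs ])

def pushReqsIn : Proc :=
  .par (forward nMro [nMo, nMruo] 4) (forward nMri [nMi, nMrui] 3)

def pushReqsOut : Proc :=
  parList
    [ .out nCr2 [nMro, nMri] .nil
    , forward nCo [nPo, nMro] 4
    , forward nMruo [nMro] 4
    , forward nCi [nPi, nMri] 3
    , forward nMrui [nMri] 3 ]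

/-- A branch of the replicated-input encoding around the encoded continuation `e`. -/
def encMAbranch (e : Proc) : Proc :=
  resList [nMo, nMi, nCo, nCi, nMruo, nMrui, nCmo, nCmi, nMuo, nMui]
    (parList
      [ pushReqsIn
      , .res nPo (.res nPi (parList [e, procRightOut, procRightIn]))
      , .res nMro (.res nMri pushReqsOut) ])

/-- `⟦y*(x).P⟧ᵐₐ`; here `y` and `pxs` are already translated by φᵐₐ and
`e` is the translation of the continuation. -/
def encMArep (y : Name) (pxs : List Name) (e : Proc) : Proc :=
  resList [nL, nR, nCr1, nCr2, nMro, nMri]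
    (parList
      [ .out nPi [y, nL, nR] .nil
      , .rep nR ([nDash, nDash, nLs, nS] ++ pxs)
          (test nLs
            (.par (lockFalse nLs) (.par (.out nS [] .nil) (.out nCr1 pxs .nil)))
            (lockFalse nLs))
      , .out nMri [y, nL, nR] .nil
      , lockTrue nL
      , .out nCr2 [nMro, nMri] .nil
      , .rep nCr1 pxs (.inp nCr2 [nMro, nMri] (encMAbranch e)) ])

def encMAcore : Proc → Proc × (Name → Proc)
  | .nil => (.res nL (.par (lockTrue nL) .nil), fun _ => .nil)
  | .succ => (.succ, fun _ => .nil)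
  | .res x P => (.res (phiMA x) (encMAcore P).1, fun _ => .nil)
  | .par P Q => (encMApar (encMAcore P).1 (encMAcore Q).1, fun _ => .nil)
  | .mat a b P => (.mat (phiMA a) (phiMA b) (encMAcore P).1, fun _ => .nil)
  | .rep y xs P => (encMArep (phiMA y) (xs.map phiMA) (encMAcore P).1, fun _ => .nil)
  | .tau P =>
      let e := (encMAcore P).1
      let s := fun l => test l (.par (lockFalse l) e) (lockFalse l)
      (.res nL (.par (lockTrue nL) (s nL)), s)
  | .out y zs P =>
      let e := (encMAcore P).1
      let s := fun l =>
        .res nS (.par (.out nPo ([phiMA y, l, nS] ++ zs.map phiMA) .nil) (.inp nS [] e))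
      (.res nL (.par (lockTrue nL) (s nL)), s)
  | .inp y xs P =>
      let e := (encMAcore P).1
      let s := fun l =>
        .res nR (.par (.out nPi [phiMA y, l, nR] .nil)
          (.rep nR ([nL1, nL2, nDash, nS] ++ xs.map phiMA)
            (test nL1
              (test nL2
                (.par (lockFalse nL1)
                  (.par (lockFalse nL2) (.par (.out nS [] .nil) e)))
                (.par (lockTrue nL1) (lockFalse nL2)))
              (lockFalse nL1))))
      (.res nL (.par (lockTrue nL) (s nL)), s)
  | .choice P Q =>
      let a := (encMAcore P).2
      let b := (encMAcore Q).2
      (.res nL (.par (lockTrue nL) (.par (a nL) (b nL))), fun l => .par (a l) (b l))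

/-- The encoding `⟦·⟧ᵐₐ` from πₘ into πₐ. -/
def encMA (P : Proc) : Proc := (encMAcore P).1

/-- `⟦π.P⟧ᵐₐ` of a summand, with `l` as the sum lock of the surrounding sum. -/
def encMASummand (l : Name) (g : Proc) : Proc := (encMAcore g).2 l

/-! ## Target terms, requests and sum locks -/

/-- Target terms of `⟦·⟧ˢₐ`: encodings of πₛ terms and their derivatives. -/
def TargetSA (T : Proc) : Prop :=
  ∃ S : Proc, IsSep S ∧ (StructCong T (encSA S) ∨ Steps (encSA S) T)

/-- Target terms of `⟦·⟧ᵐₐ`: encodings of πₘ terms and their derivatives. -/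
def TargetMA (T : Proc) : Prop :=
  ∃ S : Proc, IsMix S ∧ (StructCong T (encMA S) ∨ Steps (encMA S) T)

/-- `T` contains an unguarded input request `p̄⟨y, l, r⟩` (an output with three
parameters), i.e. `T ≡ (νx̃)(T' ∣ p̄⟨y,l,r⟩)`. -/
def hasInputRequest (T : Proc) (p y l r : Name) : Prop :=
  ∃ (xs : List Name) (T' : Proc),
    StructCong T (resList xs (.par T' (.out p [y, l, r] .nil)))

/-- `T` contains an unguarded output request `p̄⟨y, l, s, z⟩` (an output with four
parameters), i.e. `T ≡ (νx̃)(T' ∣ p̄⟨y,l,s,z⟩)`. -/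
def hasOutputRequest (T : Proc) (p y l s z : Name) : Prop :=
  ∃ (xs : List Name) (T' : Proc),
    StructCong T (resList xs (.par T' (.out p [y, l, s, z] .nil)))

/-- `T` uses the name `l` as a link (subject of an input, output or replicated input)
with multiplicity `n`. -/
def usesLink : Proc → Name → ℕ → Prop
  | .nil, _, _ => False
  | .succ, _, _ => False
  | .res x P, l, n => l ≠ x ∧ usesLink P l n
  | .par P Q, l, n => usesLink P l n ∨ usesLink Q l n
  | .mat _ _ P, l, n => usesLink P l n
  | .inp y xs P, l, n => (y = l ∧ xs.length = n) ∨ (l ∉ xs ∧ usesLink P l n)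
  | .out y zs P, l, n => (y = l ∧ zs.length = n) ∨ usesLink P l n
  | .rep y xs P, l, n => (y = l ∧ xs.length = n) ∨ (l ∉ xs ∧ usesLink P l n)
  | .tau P, l, n => usesLink P l n
  | .choice P Q, l, n => usesLink P l n ∨ usesLink Q l n

/-- `T` contains an output on the link `l` carrying exactly the values `zs`. -/
def outputsOn : Proc → Name → List Name → Prop
  | .nil, _, _ => False
  | .succ, _, _ => False
  | .res x P, l, zs => l ≠ x ∧ outputsOn P l zs
  | .par P Q, l, zs => outputsOn P l zs ∨ outputsOn Q l zs
  | .mat _ _ P, l, zs => outputsOn P l zs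
  | .inp _ xs P, l, zs => l ∉ xs ∧ outputsOn P l zs
  | .out y zs' P, l, zs => (y = l ∧ zs' = zs) ∨ outputsOn P l zs
  | .rep _ xs P, l, zs => l ∉ xs ∧ outputsOn P l zs
  | .tau P, l, zs => outputsOn P l zs
  | .choice P Q, l, zs => outputsOn P l zs ∨ outputsOn Q l zs

/-- `l` is a sum lock of `T` (Definition 14): `l` is used in `T` as a link with
multiplicity two, carrying two links with multiplicity zero. -/
def IsSumLock (T : Proc) (l : Name) : Prop :=
  usesLink T l 2 ∧ (∀ n, usesLink T l n → n = 2) ∧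
  (∀ zs, outputsOn T l zs → ∀ z ∈ zs, ∀ n, usesLink T z n → n = 0)

/-! ## Translated observables (Definition 24) -/

/-- Observables/barbs: input or output on a (source-term) name. -/
inductive Barb : Type
  | inp : Name → Barb
  | out : Name → Barb

/-- Translated observables of `⟦·⟧ˢₐ`. -/
def transBarbSA : Proc → Barb → Prop
  | T, .inp y =>
      ∃ (xs : List Name) (T' T₁ T₂ : Proc) (l l' s z : Name),
        y ∉ xs ∧
        (StructCong T
            (resList xs (.par T' (.par (.inp y [l', s, z] (test l T₁ T₂)) (lockTrue l)))) ∨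
          ∃ B : Proc, StructCong T (resList xs (.par T' (.rep y [l', s, z] B))))
  | T, .out y =>
      ∃ (xs : List Name) (T' : Proc) (l s z : Name),
        y ∉ xs ∧
        StructCong T (resList xs (.par T' (.par (.out y [l, s, z] .nil) (lockTrue l))))

/-- Translated observables of `⟦·⟧ᵐₐ`. -/
def transBarbMA : Proc → Barb → Prop
  | T, .inp y =>
      ∃ (xs : List Name) (T' : Proc) (p l r : Name),
        y ∉ xs ∧
        StructCong T (resList xs (.par T' (.par (.out p [y, l, r] .nil) (lockTrue l))))
  | T, .out y =>
      ∃ (xs : List Name) (T' : Proc) (p l s z : Name),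
        y ∉ xs ∧
        StructCong T (resList xs (.par T' (.par (.out p [y, l, s, z] .nil) (lockTrue l))))

/-- weak (reachable) translated observables -/
def weakBarb (barb : Proc → Barb → Prop) (P : Proc) (μ : Barb) : Prop :=
  ∃ P', Steps P P' ∧ barb P' μ

/-! ## Translated barbed bisimilarity (Definitions 25 and 26) and congruence -/

/-- `R` is a translated barbed bisimulation with respect to the translated
observables `barb` (Definition 25). -/
def IsTransBisim (barb : Proc → Barb → Prop) (R : Proc → Proc → Prop) : Prop :=
  ∀ P Q, R P Q →
    (reachSuccess P ↔ reachSuccess Q) ∧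
    (∀ μ, weakBarb barb P μ ↔ weakBarb barb Q μ) ∧
    (∀ P', Reduces P P' → ∃ Q', Steps Q Q' ∧ R P' Q') ∧
    (∀ Q', Reduces Q Q' → ∃ P', Steps P P' ∧ R P' Q')

/-- `R` is a weak translated barbed bisimulation (Definition 26), not
distinguishing terms by reachable intermediate states. -/
def IsTransBisim2 (barb : Proc → Barb → Prop) (R : Proc → Proc → Prop) : Prop :=
  ∀ P Q, R P Q →
    (reachSuccess P ↔ reachSuccess Q) ∧
    (∀ μ, weakBarb barb P μ ↔ weakBarb barb Q μ) ∧
    (∀ P', Steps P P' → ∃ P'' Q'', Steps Q Q'' ∧ Steps P' P'' ∧ R P'' Q'') ∧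
    (∀ Q', Steps Q Q' → ∃ Q'' P'', Steps P P'' ∧ Steps Q' Q'' ∧ R P'' Q'')

/-- Translated barbed bisimilarity `≐ˢₐ` with respect to `⟦·⟧ˢₐ`. -/
def transBisimSA (P Q : Proc) : Prop := ∃ R, IsTransBisim transBarbSA R ∧ R P Q

/-- Translated barbed bisimilarity `≐ᵐₐ,₁` with respect to `⟦·⟧ᵐₐ`. -/
def transBisimMA1 (P Q : Proc) : Prop := ∃ R, IsTransBisim transBarbMA R ∧ R P Q

/-- Weak translated barbed bisimilarity `≐ᵐₐ,₂` with respect to `⟦·⟧ᵐₐ`. -/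
def transBisimMA2 (P Q : Proc) : Prop := ∃ R, IsTransBisim2 transBarbMA R ∧ R P Q

/-- Translated barbed congruence `≅ˢₐ` (Definition 28): closure of `≐ˢₐ` under all
πₐ-contexts that map target terms to target terms. -/
def transCongSA (T₁ T₂ : Proc) : Prop :=
  ∀ C : Proc → Proc, TargetSA (C (encSA .nil)) → transBisimSA (C T₁) (C T₂)

/-- Translated barbed congruence `≅ᵐₐ,₁`. -/
def transCongMA1 (T₁ T₂ : Proc) : Prop :=
  ∀ C : Proc → Proc, TargetMA (C (encMA .nil)) → transBisimMA1 (C T₁) (C T₂)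

/-- Weak translated barbed congruence `≅ᵐₐ,₂`. -/
def transCongMA2 (T₁ T₂ : Proc) : Prop :=
  ∀ C : Proc → Proc, TargetMA (C (encMA .nil)) → transBisimMA2 (C T₁) (C T₂)

/-! ## Pieces of target terms and junk (Definitions 31 and 32) -/

/-- Pieces of target terms of `⟦·⟧ˢₐ` (Definition 31). -/
inductive PieceSA : Proc → Prop
  | target {T : Proc} : TargetSA T → PieceSA T
  | drop {T T' J : Proc} {xs : List Name} :
      StructCong T (resList xs T') →
      transCongSA T (resList xs (.par T' J)) →
      PieceSA (resList xs (.par T' J)) → PieceSA T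

/-- Pieces of target terms of `⟦·⟧ᵐₐ` (Definition 31). -/
inductive PieceMA : Proc → Prop
  | target {T : Proc} : TargetMA T → PieceMA T
  | drop {T T' J : Proc} {xs : List Name} :
      StructCong T (resList xs T') →
      transCongMA1 T (resList xs (.par T' J)) →
      PieceMA (resList xs (.par T' J)) → PieceMA T

/-- `J` is junk of `⟦·⟧ˢₐ` modulo `≐ˢₐ` (Definition 32). -/
def JunkSA (J : Proc) : Prop :=
  ∀ C : Proc → Proc, PieceSA (C J) → transBisimSA (C J) (C .nil)

/-- `J` is junk of `⟦·⟧ᵐₐ` modulo `≐ᵐₐ` (Definition 32). -/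
def JunkMA (J : Proc) : Prop :=
  ∀ C : Proc → Proc, PieceMA (C J) → transBisimMA1 (C J) (C .nil)

/-! ## Pure administrative steps (Definition 23) -/

/-- A pure administrative step of `⟦·⟧ˢₐ`: a step that is neither on a sum lock
nor on a translated source term name. -/
def PureAdminStepSA (T₁ T₂ : Proc) : Prop :=
  ∃ a : Option Name, LabStep T₁ a T₂ ∧
    ∀ l : Name, a = some l → ¬ IsSumLock T₁ l ∧ (¬ ∃ n : Name, phiSA n = l)

/-- A sequence of pure administrative steps of `⟦·⟧ˢₐ`. -/
def PureAdminStepsSA : Proc → Proc → Prop := Relation.ReflTransGen PureAdminStepSA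

/-! ## Gorla's quality criteria (Definitions 5–11) -/

/-- Criterion 1 (compositionality): every operator is translated by a fixed context,
parametrisable on the free names of its parameters, applied to the translations
of its parameters. -/
def Compositional (enc : Proc → Proc) (lang : Proc → Prop) : Prop :=
  (∃ C : Name → Finset Name → Proc → Proc,
    ∀ (x : Name) (S : Proc), lang (.res x S) → enc (.res x S) = C x (freeNames S) (enc S)) ∧
  (∃ C : Finset Name → Proc → Proc → Proc,
    ∀ S₁ S₂ : Proc, lang (.par S₁ S₂) →
      enc (.par S₁ S₂) = C (freeNames S₁ ∪ freeNames S₂) (enc S₁) (enc S₂)) ∧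
  (∃ C : Name → Name → Finset Name → Proc → Proc,
    ∀ (a b : Name) (S : Proc), lang (.mat a b S) →
      enc (.mat a b S) = C a b (freeNames S) (enc S)) ∧
  (∃ C : Name → List Name → Finset Name → Proc → Proc,
    ∀ (y : Name) (xs : List Name) (S : Proc), lang (.inp y xs S) →
      enc (.inp y xs S) = C y xs (freeNames S) (enc S)) ∧
  (∃ C : Name → List Name → Finset Name → Proc → Proc,
    ∀ (y : Name) (zs : List Name) (S : Proc), lang (.out y zs S) →
      enc (.out y zs S) = C y zs (freeNames S) (enc S)) ∧
  (∃ C : Name → List Name → Finset Name → Proc → Proc,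
    ∀ (y : Name) (xs : List Name) (S : Proc), lang (.rep y xs S) →
      enc (.rep y xs S) = C y xs (freeNames S) (enc S)) ∧
  (∃ C : Finset Name → Proc → Proc,
    ∀ S : Proc, lang (.tau S) → enc (.tau S) = C (freeNames S) (enc S)) ∧
  (∃ C : Finset Name → Proc → Proc → Proc,
    ∀ S₁ S₂ : Proc, lang (.choice S₁ S₂) →
      enc (.choice S₁ S₂) = C (freeNames S₁ ∪ freeNames S₂) (enc S₁) (enc S₂))

/-- Criterion 2 (name invariance) with respect to the renaming policy `φ` and the
equivalence `eqv` on the target. -/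
def NameInvariant (enc : Proc → Proc) (lang : Proc → Prop) (φ : Name → Name)
    (eqv : Proc → Proc → Prop) : Prop :=
  ∀ (S : Proc) (σ : Name → Name), lang S → ∃ σ' : Name → Name,
    (∀ n : Name, φ (σ n) = σ' (φ n)) ∧
    (Function.Injective σ → AlphaEq (enc (applySubst σ S)) (applySubst σ' (enc S))) ∧
    (¬ Function.Injective σ → eqv (enc (applySubst σ S)) (applySubst σ' (enc S)))

/-- operational completeness (half of Criterion 3) -/
def OperationallyComplete (enc : Proc → Proc) (lang : Proc → Prop)
    (eqv : Proc → Proc → Prop) : Prop :=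
  ∀ S S' : Proc, lang S → Steps S S' → ∃ T : Proc, Steps (enc S) T ∧ eqv T (enc S')

/-- operational soundness (half of Criterion 3) -/
def OperationallySound (enc : Proc → Proc) (lang : Proc → Prop)
    (eqv : Proc → Proc → Prop) : Prop :=
  ∀ S T : Proc, lang S → Steps (enc S) T →
    ∃ S' T' : Proc, Steps S S' ∧ Steps T T' ∧ eqv T' (enc S')

/-- Criterion 4 (divergence reflection) -/
def DivergenceReflecting (enc : Proc → Proc) (lang : Proc → Prop) : Prop :=
  ∀ S : Proc, lang S → Divergent (enc S) → Divergent S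

/-- Criterion 5 (success sensitiveness) -/
def SuccessSensitive (enc : Proc → Proc) (lang : Proc → Prop) : Prop :=
  ∀ S : Proc, lang S → (reachSuccess S ↔ reachSuccess (enc S))

/-- The equivalence `eqv` is success respecting (Definition 11). -/
def SuccessRespecting (eqv : Proc → Proc → Prop) : Prop :=
  ∀ P Q : Proc, reachSuccess P → ¬ reachSuccess Q → ¬ eqv P Q

/-- A good encoding in the sense of Gorla: it satisfies the five criteria
with respect to the behavioural equivalence `eqv` on the target language. -/
def GoodEncoding (enc : Proc → Proc) (lang : Proc → Prop) (φ : Name → Name)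
    (eqv : Proc → Proc → Prop) : Prop :=
  Compositional enc lang ∧
  NameInvariant enc lang φ eqv ∧
  OperationallyComplete enc lang eqv ∧
  OperationallySound enc lang eqv ∧
  DivergenceReflecting enc lang ∧
  SuccessSensitive enc lang

/-! ## Preservation of the degree of distribution (Definition 5 of [PN12]) -/

/-- `enc` preserves the degree of distribution: for every source term
`S ≡ᵣₑₚ S₁ ∣ … ∣ Sₙ` with `Sᵢ ⟹ Sᵢ'` there are target terms `T₁, …, Tₙ` and an
`n`-ary context `C` such that `enc S ≡ᵣₑₚ C[T₁, …, Tₙ]` and `Tᵢ ⟹ ≍ enc Sᵢ'`. -/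
def PreservesDistribution (enc : Proc → Proc) (lang : Proc → Prop)
    (eqv : Proc → Proc → Prop) : Prop :=
  ∀ (S : Proc) (SL SL' : List Proc), lang S →
    StructCongRep S (parList SL) →
    List.Forall₂ Steps SL SL' →
    ∃ (TL : List Proc) (C : List Proc → Proc),
      TL.length = SL.length ∧
      StructCongRep (enc S) (C TL) ∧
      List.Forall₂ (fun T S' => ∃ T', Steps T T' ∧ eqv T' (enc S')) TL SL'


theorem Reduces.of_structCong {P P' Q : Proc} (h : StructCong P Q) (hr : Reduces P P') :
    Reduces Q P' := by
  obtain ⟨a, ha⟩ := hr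
  exact ⟨a, .congr h.symm ha .refl⟩

theorem Steps.of_structCong {P P' Q : Proc} (h : StructCong P Q) (hs : Steps P P') :
    ∃ Q', Steps Q Q' ∧ StructCong P' Q' := by
  rcases Relation.ReflTransGen.cases_head hs with rfl | ⟨R, hR, hs⟩
  · exact ⟨Q, .refl, h⟩
  · exact ⟨P', .head (hR.of_structCong h) hs, .refl⟩

theorem reachSuccess.of_structCong {P Q : Proc} (h : StructCong P Q) (hP : reachSuccess P) :
    reachSuccess Q := by
  obtain ⟨P', P'', hs, hP'⟩ := hP
  obtain ⟨Q', hs', hQ'⟩ := hs.of_structCong h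
  exact ⟨Q', P'', hs', hQ'.symm.trans hP'⟩

theorem weakBarb.of_structCong {barb : Proc → Barb → Prop}
    (hbarb : ∀ P Q μ, StructCong P Q → barb P μ → barb Q μ) {P Q : Proc} {μ : Barb}
    (h : StructCong P Q) (hP : weakBarb barb P μ) : weakBarb barb Q μ := by
  obtain ⟨P', hs, hP'⟩ := hP
  obtain ⟨Q', hs', hQ'⟩ := hs.of_structCong h
  exact ⟨Q', hs', hbarb _ _ _ hQ' hP'⟩

theorem transBarbSA_of_structCong (P Q : Proc) (μ : Barb) (h : StructCong P Q)
    (hP : transBarbSA P μ) : transBarbSA Q μ := by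
  cases μ with
  | inp y =>
    obtain ⟨xs, T', T₁, T₂, l, l', s, z, hy, hT | ⟨B, hT⟩⟩ := hP
    · exact ⟨xs, T', T₁, T₂, l, l', s, z, hy, .inl (h.symm.trans hT)⟩
    · exact ⟨xs, T', T₁, T₂, l, l', s, z, hy, .inr ⟨B, h.symm.trans hT⟩⟩
  | out y =>
    obtain ⟨xs, T', l, s, z, hy, hT⟩ := hP
    exact ⟨xs, T', l, s, z, hy, h.symm.trans hT⟩

theorem transBarbMA_of_structCong (P Q : Proc) (μ : Barb) (h : StructCong P Q)
    (hP : transBarbMA P μ) : transBarbMA Q μ := by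
  cases μ with
  | inp y =>
    obtain ⟨xs, T', p, l, r, hy, hT⟩ := hP
    exact ⟨xs, T', p, l, r, hy, h.symm.trans hT⟩
  | out y =>
    obtain ⟨xs, T', p, l, s, z, hy, hT⟩ := hP
    exact ⟨xs, T', p, l, s, z, hy, h.symm.trans hT⟩

/-- Structural congruence is a translated barbed bisimulation for every notion of barb
that it preserves. -/
theorem isTransBisim_structCong {barb : Proc → Barb → Prop}
    (hbarb : ∀ P Q μ, StructCong P Q → barb P μ → barb Q μ) :
    IsTransBisim barb StructCong := fun _ _ h =>
  ⟨⟨.of_structCong h, .of_structCong h.symm⟩,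
    fun _ => ⟨.of_structCong hbarb h, .of_structCong hbarb h.symm⟩,
    fun P' hP => ⟨P', .single (hP.of_structCong h), .refl⟩,
    fun Q' hQ => ⟨Q', .single (hQ.of_structCong h.symm), .refl⟩⟩

/-- Translated barbed bisimilarity includes structural congruence:
for all asynchronous π-calculus terms `T₁` and `T₂`, if `T₁ ≡ T₂` then `T₁ ≐ˢₐ T₂`
and `T₁ ≐ᵐₐ T₂`. -/
theorem transBisim_includes_structCong :
    ∀ T₁ T₂ : Proc, StructCong T₁ T₂ → transBisimSA T₁ T₂ ∧ transBisimMA1 T₁ T₂ := by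
  intro T₁ T₂ h
  exact ⟨⟨StructCong, isTransBisim_structCong transBarbSA_of_structCong, h⟩,
    ⟨StructCong, isTransBisim_structCong transBarbMA_of_structCong, h⟩⟩

end PiCalc
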